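/- Let p be a prime, 1 ≤ s_1 < s_2 < ⋯ < s_ℓ = d, d = rp − 1, and integers a_{ij} with 1 ≤ a_{ij} ≤ p−1 such that for each 1 ≤ j ≤ d−1 with j ∉ {s_1,…,s_ℓ} there is a positive integer t_j with Σ_i a_{ij} = t_j p − 1 (sum over those i with j < s_i). Define the simplex Δ ⊂ ℝ^d with vertices v_0 = 0, v_i = e_i for i ∉ {0, s_1,…,s_ℓ}, and v_{s_k} = Σ_{1 ≤ j < s_k, j ∉ {s_1,…,s_{k-1}}} a_{kj} e_j + p e_{s_k}. Then Δ is Gorenstein of index r and has normalized volume p^ℓ. -/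

import Mathlib

open scoped BigOperators
open MeasureTheory

noncomputable section

/-- The real point corresponding to a lattice point. -/
def toReal {d : ℕ} (v : Fin d → ℤ) : Fin d → ℝ := fun i => (v i : ℝ)

/-- The finite abelian group `Λ_Δ ⊆ (ℝ/ℤ)^{d+1}` attached to a lattice simplex with
vertices `v 0, …, v d`. -/
def LambdaSet {d : ℕ} (v : Fin (d + 1) → Fin d → ℤ) :
    Set (Fin (d + 1) → AddCircle (1 : ℝ)) :=
  {lam | ∃ mu : Fin (d + 1) → ℝ,
    (∀ i, ((mu i : ℝ) : AddCircle (1 : ℝ)) = lam i) ∧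
    (∀ j, ∃ n : ℤ, ∑ i, mu i * (v i j : ℝ) = (n : ℝ)) ∧
    (∃ n : ℤ, ∑ i, mu i = (n : ℝ))}

/-- The simplex spanned by the given lattice points. -/
def simplexOf {d : ℕ} (v : Fin (d + 1) → Fin d → ℤ) : Set (Fin d → ℝ) :=
  convexHull ℝ (Set.range fun i => toReal (v i))

/-- The dual (polar) body `{y : ⟨x,y⟩ ≤ 1 ∀ x ∈ P}`. -/
def polarDual {d : ℕ} (P : Set (Fin d → ℝ)) : Set (Fin d → ℝ) :=
  {y | ∀ x ∈ P, ∑ i, x i * y i ≤ 1}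

/-- A point of `ℝ^d` is a lattice point if all its coordinates are integers. -/
def IsLatticePoint {d : ℕ} (x : Fin d → ℝ) : Prop := ∀ i, ∃ n : ℤ, x i = (n : ℝ)

/-- A polytope is reflexive if the origin is its unique interior lattice point and its
dual polytope is again a lattice polytope. -/
def IsReflexive {d : ℕ} (P : Set (Fin d → ℝ)) : Prop :=
  (0 ∈ interior P) ∧
  (∀ x ∈ interior P, IsLatticePoint x → x = 0) ∧
  ∃ V : Finset (Fin d → ℤ), polarDual P = convexHull ℝ (toReal '' (V : Set (Fin d → ℤ)))

/-- A lattice polytope is Gorenstein of index `r` if some lattice translate of its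
`r`-th dilate is reflexive. -/
def IsGorenstein {d : ℕ} (P : Set (Fin d → ℝ)) (r : ℕ) : Prop :=
  ∃ w : Fin d → ℤ, IsReflexive ((fun x => (r : ℝ) • x + toReal w) '' P)

/-- Unimodular equivalence of subsets of `ℝ^d`. -/
def UnimodEquiv {d : ℕ} (P Q : Set (Fin d → ℝ)) : Prop :=
  ∃ (U : Matrix (Fin d) (Fin d) ℤ) (w : Fin d → ℤ), IsUnit U.det ∧
    Q = (fun x => fun j => (∑ i, x i * (U i j : ℝ)) + (w j : ℝ)) '' P

/-- `P` is a lattice pyramid: it is unimodularly equivalent to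
`conv(V × {0}, e_j)` for a finite set `V` of lattice points lying in a coordinate
hyperplane. -/
def IsLatticePyramid {d : ℕ} (P : Set (Fin d → ℝ)) : Prop :=
  ∃ (j : Fin d) (V : Finset (Fin d → ℤ)),
    (∀ x ∈ V, x j = 0) ∧
    UnimodEquiv P (convexHull ℝ
      ((toReal '' (V : Set (Fin d → ℤ))) ∪ {fun i => if i = j then (1 : ℝ) else 0}))

/-- The vertices of the simplex `Δ(A)` associated to `A = (a 1, …, a d)`:
`v 0 = 0`, `v i = e_i` for `1 ≤ i ≤ d-1`, and
`v d = ∑_{j=1}^{d-1} (a d - a j) e_j + (a d) e_d`. -/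
def simplexVerts (d : ℕ) (a : ℕ → ℤ) : Fin (d + 1) → Fin d → ℤ := fun i j =>
  if (i : ℕ) = 0 then 0
  else if (i : ℕ) = d then (if (j : ℕ) = d - 1 then a d else a d - a ((j : ℕ) + 1))
  else if (j : ℕ) + 1 = (i : ℕ) then 1 else 0

/-- The vertices of the simplex `Δ(A,B)`: `v 0 = 0`, `v i = e_i` for
`i ∉ {0, s, d}`, `v s = ∑_{j=1}^s (a j) e_j`, `v d = ∑_{j=1}^d (b j) e_j`. -/
def simplexVerts2 (d s : ℕ) (a b : ℕ → ℤ) : Fin (d + 1) → Fin d → ℤ := fun i j =>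
  if (i : ℕ) = 0 then 0
  else if (i : ℕ) = s then (if (j : ℕ) + 1 ≤ s then a ((j : ℕ) + 1) else 0)
  else if (i : ℕ) = d then b ((j : ℕ) + 1)
  else if (j : ℕ) + 1 = (i : ℕ) then 1 else 0

/-- The vertices of the simplex of Theorem `power`: `v 0 = 0`, `v i = e_i` for
`i ∉ {0, s 1, …, s ℓ}`, and
`v (s k) = ∑_{1 ≤ j < s k, j ∉ {s 1,…,s (k-1)}} a k j • e_j + p • e_(s k)`.
(Here `a` is indexed by the `Fin ℓ`-index of the nonstandard row, 0-based.) -/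
def powerVerts (p d ℓ : ℕ) (s : Fin ℓ → ℕ) (a : ℕ → ℕ → ℤ) :
    Fin (d + 1) → Fin d → ℤ := fun i j =>
  if (i : ℕ) = 0 then 0
  else if hk : ∃ k : Fin ℓ, s k = (i : ℕ) then
    (if (j : ℕ) + 1 = (i : ℕ) then (p : ℤ)
     else if (j : ℕ) + 1 < (i : ℕ) ∧ ¬ ∃ k' : Fin ℓ, s k' = (j : ℕ) + 1 then
       a (hk.choose : ℕ) ((j : ℕ) + 1)
     else 0)
  else if (j : ℕ) + 1 = (i : ℕ) then 1 else 0

/-- The corner simplex `{z ≥ 0, ∑ z ≤ t}`. -/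
def cornerSimplex (d : ℕ) (t : ℝ) : Set (Fin d → ℝ) :=
  {z | (∀ i, 0 ≤ z i) ∧ ∑ i, z i ≤ t}

lemma convex_cornerSimplex (d : ℕ) (t : ℝ) : Convex ℝ (cornerSimplex d t) := by
  rintro x ⟨hx, hx'⟩ y ⟨hy, hy'⟩ α β hα hβ hαβ
  refine ⟨fun i => ?_, ?_⟩
  · have := hx i
    have := hy i
    simp only [Pi.add_apply, Pi.smul_apply, smul_eq_mul]
    positivity
  · simp only [Pi.add_apply, Pi.smul_apply, smul_eq_mul, Finset.sum_add_distrib,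
      ← Finset.mul_sum]
    calc _ ≤ α * t + β * t := by gcongr
      _ = t := by rw [← add_mul, hαβ, one_mul]

lemma volume_cornerSimplex (d : ℕ) {t : ℝ} (ht : 0 ≤ t) :
    volume (cornerSimplex d t) = ENNReal.ofReal (t ^ d / d.factorial) := by
  induction d generalizing t with
  | zero =>
    have : cornerSimplex 0 t = Set.univ := by
      ext z; simp [cornerSimplex, ht]
    simp [this, volume_pi]
  | succ d ih =>
    have hpre : cornerSimplex (d + 1) t =
        MeasurableEquiv.piFinSuccAbove (fun _ => ℝ) 0 ⁻¹'
          {q : ℝ × (Fin d → ℝ) | 0 ≤ q.1 ∧ q.2 ∈ cornerSimplex d (t - q.1)} := by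
      ext z
      simp only [cornerSimplex, Set.mem_ofPred_eq, Fin.forall_fin_succ, Fin.sum_univ_succ,
        Set.mem_preimage, MeasurableEquiv.piFinSuccAbove_apply, Fin.insertNthEquiv_symm_apply,
        Fin.removeNth, Fin.succAbove_zero, and_assoc, le_sub_iff_add_le, add_comm]
    have hmeas : MeasurableSet
        {q : ℝ × (Fin d → ℝ) | 0 ≤ q.1 ∧ q.2 ∈ cornerSimplex d (t - q.1)} := by
      have : IsClosed {q : ℝ × (Fin d → ℝ) | 0 ≤ q.1 ∧ q.2 ∈ cornerSimplex d (t - q.1)} := by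
        have heq : {q : ℝ × (Fin d → ℝ) | 0 ≤ q.1 ∧ q.2 ∈ cornerSimplex d (t - q.1)} =
            {q | 0 ≤ q.1} ∩ ((⋂ i, {q | 0 ≤ q.2 i}) ∩ {q | ∑ i, q.2 i ≤ t - q.1}) := by
          ext q
          simp [cornerSimplex]
        rw [heq]
        refine IsClosed.inter ?_ (IsClosed.inter (isClosed_iInter fun i => ?_) ?_)
        · exact isClosed_le continuous_const continuous_fst
        · exact isClosed_le continuous_const (by fun_prop)
        · exact isClosed_le (by fun_prop) (by fun_prop)
      exact this.measurableSet
    rw [hpre, (volume_preserving_piFinSuccAbove (fun _ => ℝ) 0).measure_preimage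
      hmeas.nullMeasurableSet, Measure.volume_eq_prod, Measure.prod_apply hmeas]
    have hfib : ∀ x : ℝ, volume (Prod.mk x ⁻¹'
        {q : ℝ × (Fin d → ℝ) | 0 ≤ q.1 ∧ q.2 ∈ cornerSimplex d (t - q.1)}) =
        (Set.Icc 0 t).indicator (fun x => ENNReal.ofReal ((t - x) ^ d / d.factorial)) x := by
      intro x
      by_cases hx : x ∈ Set.Icc 0 t
      · rw [Set.indicator_of_mem hx, ← ih (sub_nonneg.2 hx.2)]
        congr 1
        ext z
        simp [hx.1]
      · rw [Set.indicator_of_notMem hx]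
        convert measure_empty (μ := volume)
        rw [Set.eq_empty_iff_forall_notMem]
        rintro z ⟨h0, h1, h2⟩
        refine hx ⟨h0, ?_⟩
        have := Finset.sum_nonneg fun i (_ : i ∈ Finset.univ) => h1 i
        simp only at h0 h2 this
        linarith
    simp_rw [hfib]
    rw [lintegral_indicator measurableSet_Icc, ← ofReal_integral_eq_lintegral_ofReal]
    · congr 1
      rw [integral_Icc_eq_integral_Ioc, ← intervalIntegral.integral_of_le ht,
        intervalIntegral.integral_comp_sub_left (fun x => x ^ d / (d.factorial : ℝ)) t,
        intervalIntegral.integral_div, integral_pow, Nat.factorial_succ]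
      have : (d.factorial : ℝ) ≠ 0 := by positivity
      push_cast
      field_simp
      simp
    · exact (Continuous.continuousOn (by fun_prop)).integrableOn_Icc
    · filter_upwards [ae_restrict_mem measurableSet_Icc] with x hx
      have := sub_nonneg.2 hx.2
      simp only [Pi.zero_apply]
      positivity

/-- A lattice simplex with a vertex at the origin is a linear image of the corner simplex. -/
lemma simplexOf_eq_image {d : ℕ} (v : Fin (d + 1) → Fin d → ℤ) (h0 : v 0 = 0)
    (V : Matrix (Fin d) (Fin d) ℝ) (hV : ∀ i j, V i j = v i.succ j) :
    simplexOf v = V.vecMulLinear '' cornerSimplex d 1 := by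
  have hrow : ∀ i : Fin d, toReal (v i.succ) = V i := fun i => funext fun j => (hV i j).symm
  have hzero : toReal (v 0) = 0 := by ext j; simp [toReal, h0]
  refine subset_antisymm (convexHull_min ?_ ((convex_cornerSimplex d 1).linear_image _)) ?_
  · rintro _ ⟨i, rfl⟩
    refine Fin.cases ?_ (fun i => ?_) i
    · exact ⟨0, by simp [cornerSimplex], by simp [hzero]⟩
    · refine ⟨Pi.single i 1, ⟨fun j => ?_, by simp⟩, ?_⟩
      · by_cases h : j = i
        · subst h; simp
        · simp [h]
      · simp only [Matrix.vecMulLinear_apply, Matrix.single_one_vecMul, hrow]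
        rfl
  · rintro _ ⟨z, ⟨hz, hz'⟩, rfl⟩
    refine mem_convexHull_of_exists_fintype (Fin.cons (1 - ∑ i, z i) z)
      (fun i => toReal (v i)) ?_ ?_ (fun i => ⟨i, rfl⟩) ?_
    · refine Fin.cases ?_ (fun i => ?_)
      · simpa using hz'
      · simpa using hz i
    · simp [Fin.sum_univ_succ]
    · rw [Fin.sum_univ_succ]
      ext j
      simp [hzero, hrow, Matrix.vecMul, dotProduct, Finset.sum_apply]

lemma volume_simplexOf {d : ℕ} (v : Fin (d + 1) → Fin d → ℤ) (h0 : v 0 = 0)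
    (V : Matrix (Fin d) (Fin d) ℤ) (hV : ∀ i j, V i j = v i.succ j) :
    (d.factorial : ENNReal) * volume (simplexOf v) = (V.det.natAbs : ENNReal) := by
  have key : (V.map (Int.cast : ℤ → ℝ)).vecMulLinear =
      Matrix.toLin' (V.map (Int.cast : ℤ → ℝ)).transpose := by
    ext x j
    simp
  have hdet : (V.map (Int.cast : ℤ → ℝ)).det = V.det := by
    simpa using (RingHom.map_det (Int.castRingHom ℝ) V).symm
  rw [simplexOf_eq_image v h0 (V.map (Int.cast : ℤ → ℝ)) (by simp [hV]),
    Measure.addHaar_image_linearMap, volume_cornerSimplex d zero_le_one, key,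
    LinearMap.det_toLin', Matrix.det_transpose, hdet, one_pow, one_div,
    ENNReal.ofReal_inv_of_pos (by positivity), ENNReal.ofReal_natCast, mul_left_comm,
    ENNReal.mul_inv_cancel (by positivity) (by simp), mul_one, ← Int.cast_abs,
    Int.abs_eq_natAbs, Int.cast_natCast, ENNReal.ofReal_natCast]

/-- The translated dilate in facet coordinates. -/
lemma image_smul_add_simplexOf {d p r : ℕ} (hp : 0 < p) (hr : 0 < r) (hd : d + 1 = r * p)
    (v : Fin (d + 1) → Fin d → ℤ) (h0 : v 0 = 0)
    (V M : Matrix (Fin d) (Fin d) ℝ) (hV : ∀ i j, V i j = v i.succ j)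
    (hVM : V * M = (p : ℝ) • 1) (w : Fin d → ℤ)
    (hw : Matrix.vecMul (toReal w) M = 1) :
    (fun x => (r : ℝ) • x + toReal (-w)) '' simplexOf v =
      {x | (∀ i, -1 ≤ Matrix.vecMul x M i) ∧ ∑ i, Matrix.vecMul x M i ≤ 1} := by
  have hneg : toReal (-w) = -toReal w := by ext; simp [toReal]
  have hp' : (0 : ℝ) < p := by exact_mod_cast hp
  have hr' : (0 : ℝ) < r := by exact_mod_cast hr
  have hdR : (d : ℝ) + 1 = r * p := by exact_mod_cast hd
  have hMV : M * V = (p : ℝ) • 1 := by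
    have : ((p : ℝ)⁻¹ • V) * M = 1 := by
      rw [Matrix.smul_mul, hVM, smul_smul, inv_mul_cancel₀ hp'.ne', one_smul]
    have := mul_eq_one_comm.1 this
    rw [Matrix.mul_smul] at this
    rw [← this, smul_smul, mul_inv_cancel₀ hp'.ne', one_smul]
  rw [simplexOf_eq_image v h0 V hV, Set.image_image]
  ext x
  constructor
  · rintro ⟨z, ⟨hz, hz'⟩, rfl⟩
    have hc : ∀ i, Matrix.vecMul ((r : ℝ) • V.vecMulLinear z + toReal (-w)) M i =
        r * p * z i - 1 := by
      intro i
      rw [hneg, Matrix.add_vecMul, Matrix.neg_vecMul, hw, Matrix.smul_vecMul,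
        Matrix.vecMulLinear_apply, Matrix.vecMul_vecMul, hVM]
      simp [Matrix.vecMul_smul]
      ring
    simp only [Set.mem_ofPred_eq, hc, Finset.sum_sub_distrib, ← Finset.mul_sum]
    refine ⟨fun i => ?_, ?_⟩
    · have := hz i
      have : 0 ≤ (r : ℝ) * p * z i := by positivity
      linarith
    · simp only [Finset.sum_const, Finset.card_univ, Fintype.card_fin, nsmul_eq_mul, mul_one]
      nlinarith [mul_le_mul_of_nonneg_left hz' (mul_pos hr' hp').le]
  · rintro ⟨h1, h2⟩
    refine ⟨((r : ℝ) * p)⁻¹ • (Matrix.vecMul x M + 1), ⟨fun i => ?_, ?_⟩, ?_⟩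
    · have := h1 i
      have : 0 ≤ Matrix.vecMul x M i + 1 := by linarith
      simp only [Pi.smul_apply, Pi.add_apply, Pi.one_apply, smul_eq_mul]
      positivity
    · simp only [Pi.smul_apply, Pi.add_apply, Pi.one_apply, smul_eq_mul, ← Finset.mul_sum,
        Finset.sum_add_distrib]
      rw [inv_mul_le_iff₀ (by positivity)]
      simp only [Finset.sum_const, Finset.card_univ, Fintype.card_fin, nsmul_eq_mul, mul_one]
      linarith
    · have hx : Matrix.vecMul (Matrix.vecMul x M + 1) V = (p : ℝ) • (x + toReal w) := by
        rw [← hw, ← Matrix.add_vecMul, Matrix.vecMul_vecMul, hMV, Matrix.vecMul_smul,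
          Matrix.vecMul_one]
      simp only [Matrix.vecMulLinear_apply, Matrix.smul_vecMul, hx, hneg, smul_smul]
      have : (r : ℝ) * ((r * p : ℝ)⁻¹ * p) = 1 := by field_simp
      rw [this, one_smul]
      simp

lemma map_intCast_mul_map_intCast {d p : ℕ} {V M : Matrix (Fin d) (Fin d) ℤ}
    (hVM : V * M = (p : ℤ) • 1) :
    V.map (Int.cast : ℤ → ℝ) * M.map (Int.cast : ℤ → ℝ) = (p : ℝ) • 1 := by
  have := congrArg (fun A : Matrix (Fin d) (Fin d) ℤ => A.map (Int.castRingHom ℝ)) hVM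
  simp only [Matrix.map_mul] at this
  refine this.trans ?_
  ext i j
  simp only [Matrix.map_apply, Matrix.smul_apply, Matrix.one_apply, smul_eq_mul]
  split_ifs <;> simp

lemma isReflexive_of_facet_coordinates {d p : ℕ} (hp : 0 < p)
    (V M : Matrix (Fin d) (Fin d) ℤ) (hVM : V * M = (p : ℤ) • 1) :
    IsReflexive {x : Fin d → ℝ | (∀ i, -1 ≤ Matrix.vecMul x (M.map (Int.cast : ℤ → ℝ)) i) ∧
      ∑ i, Matrix.vecMul x (M.map (Int.cast : ℤ → ℝ)) i ≤ 1} := by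
  set N : Matrix (Fin d) (Fin d) ℝ := M.map (Int.cast : ℤ → ℝ) with hN
  obtain ⟨W, hWN, hNW⟩ : ∃ W : Matrix (Fin d) (Fin d) ℝ, W * N = 1 ∧ N * W = 1 := by
    have hp' : (p : ℝ) ≠ 0 := by exact_mod_cast hp.ne'
    have h1 : ((p : ℝ)⁻¹ • V.map (Int.cast : ℤ → ℝ)) * N = 1 := by
      rw [Matrix.smul_mul, map_intCast_mul_map_intCast hVM, smul_smul, inv_mul_cancel₀ hp', one_smul]
    exact ⟨_, h1, mul_eq_one_comm.1 h1⟩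
  set Q : Set (Fin d → ℝ) := {x | (∀ i, -1 ≤ Matrix.vecMul x N i) ∧
    ∑ i, Matrix.vecMul x N i ≤ 1} with hQ
  have hcont : ∀ i, Continuous fun x : Fin d → ℝ => Matrix.vecMul x N i := fun i => by
    simp only [Matrix.vecMul, dotProduct]
    fun_prop
  refine ⟨?_, ?_, ?_⟩
  · have hopen : IsOpen {x : Fin d → ℝ | (∀ i, -1 < Matrix.vecMul x N i) ∧
        ∑ i, Matrix.vecMul x N i < 1} := by
      simp only [Set.ofPred_and, Set.ofPred_forall]
      refine IsOpen.inter (isOpen_iInter_of_finite fun i => ?_) ?_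
      · exact isOpen_lt continuous_const (hcont i)
      · exact isOpen_lt (continuous_finsetSum _ fun i _ => hcont i) continuous_const
    refine mem_interior.2 ⟨_, fun x hx => ⟨fun i => (hx.1 i).le, hx.2.le⟩, hopen, ?_⟩
    simp
  · intro x hx hlat
    choose n hn using hlat
    have hev : ∀ᶠ c : ℝ in nhds 1, c • x ∈ Q := by
      have hc : Continuous fun c : ℝ => c • x := by fun_prop
      have := hc.continuousAt (x := 1)
      refine this.eventually (p := (· ∈ Q)) ?_
      simp only [one_smul]
      exact mem_interior_iff_mem_nhds.1 hx
    obtain ⟨c, hcQ, hc1⟩ : ∃ c : ℝ, c • x ∈ Q ∧ 1 < c :=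
      ((hev.filter_mono nhdsWithin_le_nhds).and
        (self_mem_nhdsWithin : Set.Ioi (1 : ℝ) ∈ nhdsWithin 1 (Set.Ioi 1))).exists
    have hc0 : 0 < c := by linarith
    have hxN : ∀ i, Matrix.vecMul x N i = (Matrix.vecMul n M i : ℤ) := fun i => by
      simp [Matrix.vecMul, dotProduct, hn, hN]
    obtain ⟨h1, h2⟩ := hcQ
    simp only [Matrix.smul_vecMul, Pi.smul_apply, smul_eq_mul, ← Finset.mul_sum, hxN] at h1 h2
    have hnn : ∀ i, 0 ≤ Matrix.vecMul n M i := fun i => by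
      have h : (-1 : ℝ) < (Matrix.vecMul n M i : ℤ) := by
        by_contra! hle
        nlinarith [h1 i]
      have h' : (-1 : ℤ) < Matrix.vecMul n M i := by exact_mod_cast h
      omega
    have hs : ∑ i, Matrix.vecMul n M i ≤ 0 := by
      have h : ((∑ i, Matrix.vecMul n M i : ℤ) : ℝ) < 1 := by
        push_cast
        by_contra! hle
        nlinarith
      have h' : ∑ i, Matrix.vecMul n M i < 1 := by exact_mod_cast h
      omega
    have hz : Matrix.vecMul x N = 0 := by
      have hs0 := le_antisymm hs (Finset.sum_nonneg fun i _ => hnn i)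
      rw [Finset.sum_eq_zero_iff_of_nonneg fun i _ => hnn i] at hs0
      ext i
      rw [hxN, hs0 i (Finset.mem_univ i)]
      simp
    rw [← Matrix.vecMul_one x, ← hNW, ← Matrix.vecMul_vecMul, hz, Matrix.zero_vecMul]
  · classical
    let g : Fin (d + 1) → Fin d → ℤ := Fin.cons (fun j => ∑ i, M j i) fun i j => -M j i
    refine ⟨Finset.univ.image g, ?_⟩
    have hg0 : ∀ x : Fin d → ℝ, ∑ j, x j * toReal (g 0) j = ∑ i, Matrix.vecMul x N i := by
      intro x
      simp only [g, toReal, Fin.cons_zero, Matrix.vecMul, dotProduct, hN, Matrix.map_apply]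
      push_cast
      simp only [Finset.mul_sum]
      exact Finset.sum_comm
    have hgs : ∀ (x : Fin d → ℝ) i, ∑ j, x j * toReal (g i.succ) j = -Matrix.vecMul x N i := by
      intro x i
      simp [g, toReal, Matrix.vecMul, dotProduct, hN]
    refine subset_antisymm ?_ (convexHull_min ?_ ?_)
    · intro y hy
      set q := Matrix.mulVec W y with hq
      have hyq : y = Matrix.mulVec N q := by
        rw [hq, Matrix.mulVec_mulVec, hNW, Matrix.one_mulVec]
      have hle : ∀ z : Fin d → ℝ, (∀ i, -1 ≤ z i) → ∑ i, z i ≤ 1 → ∑ i, z i * q i ≤ 1 := by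
        intro z hz hz'
        have hzN : Matrix.vecMul (Matrix.vecMul z W) N = z := by
          rw [Matrix.vecMul_vecMul, hWN, Matrix.vecMul_one]
        have := hy (Matrix.vecMul z W) (by simpa only [hQ, Set.mem_ofPred_eq, hzN] using ⟨hz, hz'⟩)
        rwa [← dotProduct, ← Matrix.dotProduct_mulVec] at this
      have hd0 : (0 : ℝ) < d + 1 := by positivity
      have hA : -∑ i, q i ≤ 1 := by
        simpa using hle (fun _ => -1) (fun _ => le_rfl) (by
          simp only [Finset.sum_const, Finset.card_univ, Fintype.card_fin, nsmul_eq_mul]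
          linarith)
      have hB : ∀ i, ((d : ℝ) + 1) * q i - ∑ j, q j ≤ 1 := by
        intro i
        have := hle (fun j => (if j = i then (d : ℝ) + 1 else 0) - 1) (fun j => by
          split_ifs <;> linarith) (by simp [Finset.sum_sub_distrib])
        simpa [sub_mul, Finset.sum_sub_distrib] using this
      set b := (1 + ∑ i, q i) / ((d : ℝ) + 1) with hb
      have hbd : b * (d + 1) = 1 + ∑ i, q i := div_mul_cancel₀ _ hd0.ne'
      refine mem_convexHull_of_exists_fintype (Fin.cons b fun i => b - q i)
        (fun i => toReal (g i)) ?_ ?_ (fun i => ⟨g i, by simp, rfl⟩) ?_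
      · refine Fin.cases ?_ fun i => ?_
        · simp only [Fin.cons_zero]
          exact div_nonneg (by linarith) hd0.le
        · simp only [Fin.cons_succ]
          rw [sub_nonneg, le_div_iff₀ hd0]
          linarith [hB i]
      · simp only [Fin.sum_univ_succ, Fin.cons_zero, Fin.cons_succ, Finset.sum_sub_distrib,
          Finset.sum_const, Finset.card_univ, Fintype.card_fin, nsmul_eq_mul]
        linarith
      · rw [hyq]
        ext j
        simp only [Fin.sum_univ_succ, Fin.cons_zero, Fin.cons_succ,
          Finset.sum_apply, Pi.smul_apply, smul_eq_mul, g, toReal, Matrix.mulVec, dotProduct,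
          hN, Matrix.map_apply]
        push_cast
        rw [Finset.mul_sum, ← Finset.sum_add_distrib]
        exact Finset.sum_congr rfl fun i _ => by ring
    · rintro _ ⟨y, hy, rfl⟩ x ⟨hx, hx'⟩
      obtain ⟨i, rfl⟩ : ∃ i, g i = y := by simpa using hy
      revert i
      refine Fin.cases (fun _ => ?_) fun i _ => ?_
      · rwa [hg0]
      · rw [hgs]
        linarith [hx i]
    · intro y hy y' hy' α β hα hβ hαβ x hx
      have h1 := hy x hx
      have h2 := hy' x hx
      simp only [Pi.add_apply, Pi.smul_apply, smul_eq_mul, mul_add, Finset.sum_add_distrib,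
        mul_left_comm (x _), ← Finset.mul_sum]
      calc _ ≤ α * 1 + β * 1 := by gcongr
        _ = 1 := by linarith

lemma isGorenstein_simplexOf {d p r : ℕ} (hp : 0 < p) (hr : 0 < r) (hd : d + 1 = r * p)
    (v : Fin (d + 1) → Fin d → ℤ) (h0 : v 0 = 0)
    (V M : Matrix (Fin d) (Fin d) ℤ) (hV : ∀ i j, V i j = v i.succ j)
    (hVM : V * M = (p : ℤ) • 1) (w : Fin d → ℤ) (hw : Matrix.vecMul w M = 1) :
    IsGorenstein (simplexOf v) r := by
  refine ⟨-w, ?_⟩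
  rw [image_smul_add_simplexOf hp hr hd v h0 (V.map (Int.cast : ℤ → ℝ))
    (M.map (Int.cast : ℤ → ℝ)) (by simp [hV]) ?_ w ?_]
  · exact isReflexive_of_facet_coordinates hp V M hVM
  · exact map_intCast_mul_map_intCast hVM
  · ext j
    have := congrArg (Int.cast : ℤ → ℝ) (congrFun hw j)
    simpa [Matrix.vecMul, dotProduct, toReal] using this

lemma diagonal_add_mul_diagonal_sub {d : ℕ} (p : ℤ) (S : Fin d → Prop) [DecidablePred S]
    (E : Matrix (Fin d) (Fin d) ℤ) (hE : ∀ i j, E i j ≠ 0 → S i ∧ ¬ S j) :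
    (Matrix.diagonal (fun i => if S i then p else 1) + E) *
      (Matrix.diagonal (fun i => if S i then 1 else p) - E) = p • 1 := by
  have hEE : E * E = 0 := by
    ext i k
    rw [Matrix.mul_apply]
    refine Finset.sum_eq_zero fun j _ => ?_
    by_contra h
    exact (hE i j (left_ne_zero_of_mul h)).2 (hE j k (right_ne_zero_of_mul h)).1
  have h1 : Matrix.diagonal (fun i => if S i then p else 1) * E = p • E := by
    ext i j
    by_cases h : E i j = 0
    · simp [Matrix.diagonal_mul, h]
    · simp [Matrix.diagonal_mul, (hE i j h).1]
  have h2 : E * Matrix.diagonal (fun i => if S i then 1 else p) = p • E := by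
    ext i j
    by_cases h : E i j = 0
    · simp [Matrix.mul_diagonal, h]
    · simp [Matrix.mul_diagonal, (hE i j h).2, mul_comm]
  have h3 : Matrix.diagonal (fun i => if S i then p else 1) *
      Matrix.diagonal (fun i => if S i then 1 else p) = p • (1 : Matrix (Fin d) (Fin d) ℤ) := by
    rw [Matrix.diagonal_mul_diagonal, ← Matrix.diagonal_one, ← Matrix.diagonal_smul]
    congr 1
    ext i
    by_cases h : S i <;> simp [h]
  rw [add_mul, mul_sub, mul_sub, h1, h2, h3, hEE]
  abel

lemma vecMul_diagonal_sub_eq_one {d : ℕ} (p : ℤ) (S : Fin d → Prop) [DecidablePred S]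
    (E : Matrix (Fin d) (Fin d) ℤ) (hE : ∀ i j, E i j ≠ 0 → S i ∧ ¬ S j) (t : Fin d → ℤ)
    (ht : ∀ j, ¬ S j → ∑ i, E i j = t j * p - 1) :
    Matrix.vecMul (fun i => if S i then 1 else t i)
      (Matrix.diagonal (fun i => if S i then 1 else p) - E) = 1 := by
  have hwE : ∀ i j, (if S i then 1 else t i) * E i j = E i j := fun i j => by
    by_cases h : E i j = 0
    · simp [h]
    · simp [(hE i j h).1]
  ext j
  rw [Matrix.vecMul_sub, Pi.sub_apply, Matrix.vecMul_diagonal]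
  simp only [Matrix.vecMul, dotProduct, hwE, Pi.one_apply]
  by_cases h : S j
  · have : ∀ i, E i j = 0 := fun i => by
      by_contra hne
      exact (hE i j hne).2 h
    simp [h, this]
  · simp [h, ht j h]

/-- The entries of `powerVerts` off the diagonal, with the vertex at the origin removed. -/
def powerOffDiag (p d ℓ : ℕ) (s : Fin ℓ → ℕ) (a : ℕ → ℕ → ℤ) : Matrix (Fin d) (Fin d) ℤ :=
  fun i j => if j = i then 0 else powerVerts p d ℓ s a i.succ j

lemma powerOffDiag_support {p d ℓ : ℕ} {s : Fin ℓ → ℕ} {a : ℕ → ℕ → ℤ} {i j : Fin d}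
    (h : powerOffDiag p d ℓ s a i j ≠ 0) :
    j < i ∧ (∃ k, s k = (i : ℕ) + 1) ∧ ¬ ∃ k, s k = (j : ℕ) + 1 := by
  unfold powerOffDiag powerVerts at h
  have hji : j ≠ i := by
    rintro rfl
    simp at h
  have hval : (j : ℕ) ≠ i := fun e => hji (Fin.ext e)
  simp only [Fin.val_succ, Nat.succ_ne_zero, add_left_inj, hji, hval, if_false] at h
  split_ifs at h with h1 h2
  · exact ⟨by rw [Fin.lt_def]; omega, h1, h2.2⟩
  all_goals exact absurd rfl h

lemma powerVerts_succ (p d ℓ : ℕ) (s : Fin ℓ → ℕ) (a : ℕ → ℕ → ℤ)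
    [DecidablePred fun i : Fin d => ∃ k, s k = (i : ℕ) + 1] (i j : Fin d) :
    (Matrix.diagonal (fun i : Fin d => if ∃ k, s k = (i : ℕ) + 1 then (p : ℤ) else 1) +
      powerOffDiag p d ℓ s a) i j = powerVerts p d ℓ s a i.succ j := by
  by_cases h : j = i
  · subst h
    by_cases hS : ∃ k, s k = (j : ℕ) + 1 <;> simp [powerOffDiag, powerVerts, hS]
  · simp [powerOffDiag, h, Matrix.diagonal_apply_ne _ (Ne.symm h)]

lemma powerOffDiag_special {p d ℓ : ℕ} {s : Fin ℓ → ℕ} (hs : Function.Injective s)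
    {a : ℕ → ℕ → ℤ} {i j : Fin d} {k : Fin ℓ} (hk : s k = (i : ℕ) + 1)
    (hj : ¬ ∃ k, s k = (j : ℕ) + 1) :
    powerOffDiag p d ℓ s a i j = if (j : ℕ) + 1 < s k then a k (j + 1) else 0 := by
  have hex : ∃ k, s k = (i : ℕ) + 1 := ⟨k, hk⟩
  have hch : hex.choose = k := hs (hex.choose_spec.trans hk.symm)
  have hji : j ≠ i := by
    rintro rfl
    exact hj hex
  have hval : (j : ℕ) ≠ i := fun e => hji (Fin.ext e)
  simp only [powerOffDiag, powerVerts, Fin.val_succ, Nat.succ_ne_zero, add_left_inj, hji, hval,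
    if_false, hex, dif_pos, hj, not_false_eq_true, and_true, hk, hch]

/-- the simplex built from `1 ≤ s 1 < ⋯ < s ℓ = d`, `d = rp - 1`,
`1 ≤ a k j ≤ p - 1`, with each nonspecial column summing to `t_j p - 1`, is
Gorenstein of index `r` and has normalized volume `p^ℓ`. -/
theorem statement18 (p : ℕ) (hp : p.Prime) (d ℓ r : ℕ) (hℓ : 1 ≤ ℓ) (hr : 1 ≤ r)
    (s : Fin ℓ → ℕ) (hmono : StrictMono s)
    (hs1 : ∀ k, 1 ≤ s k) (hsle : ∀ k, s k ≤ d) (hsd : ∃ k, s k = d)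
    (hd : d + 1 = r * p) (a : ℕ → ℕ → ℤ)
    (ha : ∀ (k : Fin ℓ) (j : ℕ), 1 ≤ j → j < s k → (¬ ∃ k' : Fin ℓ, s k' = j) →
      1 ≤ a (k : ℕ) j ∧ a (k : ℕ) j ≤ (p : ℤ) - 1)
    (ht : ∀ j : ℕ, 1 ≤ j → j ≤ d - 1 → (¬ ∃ k' : Fin ℓ, s k' = j) →
      ∃ t : ℕ, 1 ≤ t ∧
        (∑ k : Fin ℓ, if j < s k then a (k : ℕ) j else 0) = (t : ℤ) * p - 1) :
    IsGorenstein (simplexOf (powerVerts p d ℓ s a)) r ∧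
      (Nat.factorial d : ENNReal) * volume (simplexOf (powerVerts p d ℓ s a))
        = ((p ^ ℓ : ℕ) : ENNReal) := by
  classical
  have hsucc : ∀ k, s k - 1 + 1 = s k := fun k => Nat.sub_add_cancel (hs1 k)
  let e : Fin ℓ → Fin d := fun k => ⟨s k - 1, by have := hs1 k; have := hsle k; omega⟩
  have he : Function.Injective e := fun k k' h => hmono.injective <| by
    rw [← hsucc k, ← hsucc k', show s k - 1 = s k' - 1 from congrArg Fin.val h]
  let S : Fin d → Prop := fun i => ∃ k, s k = (i : ℕ) + 1
  have hSe : ∀ i, S i ↔ ∃ k, e k = i := fun i => by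
    refine exists_congr fun k => ?_
    rw [Fin.ext_iff, ← hsucc k]
    simp [e]
  set E := powerOffDiag p d ℓ s a
  have hE : ∀ i j, E i j ≠ 0 → S i ∧ ¬ S j := fun i j h => (powerOffDiag_support h).2
  have h0 : powerVerts p d ℓ s a 0 = 0 := by
    ext j
    simp [powerVerts]
  have hV := powerVerts_succ p d ℓ s a
  have hcol : ∀ j : Fin d, ¬ S j → ∃ t : ℤ, ∑ i, E i j = t * p - 1 := by
    intro j hj
    obtain ⟨k₀, hk₀⟩ := hsd
    have hjd : (j : ℕ) + 1 ≤ d - 1 := by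
      have hne : (j : ℕ) + 1 ≠ d := fun h => hj ⟨k₀, hk₀.trans h.symm⟩
      have := j.isLt
      omega
    obtain ⟨t, -, ht'⟩ := ht (j + 1) (Nat.le_add_left 1 j) hjd hj
    refine ⟨t, ht' ▸ Eq.symm ?_⟩
    refine Finset.sum_of_injOn e he.injOn (by simp) (fun i _ hi => ?_) fun k _ => ?_
    · by_contra hne
      obtain ⟨k, hk⟩ := (hSe i).1 (hE i j hne).1
      exact hi ⟨k, by simp, hk⟩
    · exact (powerOffDiag_special hmono.injective (hsucc k).symm hj).symm
  choose! t ht' using hcol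
  refine ⟨isGorenstein_simplexOf hp.pos hr hd _ h0 _ _ hV
    (diagonal_add_mul_diagonal_sub p S E hE) _ (vecMul_diagonal_sub_eq_one p S E hE t ht'), ?_⟩
  rw [volume_simplexOf _ h0 _ hV, Matrix.det_of_isLowerTriangular]
  · have hdiag : ∀ i, (Matrix.diagonal (fun i => if S i then (p : ℤ) else 1) + E) i i =
        if S i then (p : ℤ) else 1 := fun i => by
      simp [E, powerOffDiag]
    have hcard : (Finset.univ.filter S).card = ℓ := by
      have : Finset.univ.filter S = Finset.univ.image e := by
        ext i
        simp [hSe]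
      rw [this, Finset.card_image_of_injective _ he, Finset.card_univ, Fintype.card_fin]
    rw [Finset.prod_congr rfl fun i _ => hdiag i, Finset.prod_ite, Finset.prod_const, hcard]
    simp [Int.natAbs_pow]
  · intro i j hij
    have hij' : i < j := hij
    rw [Matrix.add_apply, Matrix.diagonal_apply_ne _ hij'.ne, zero_add]
    by_contra h
    exact absurd (powerOffDiag_support h).1 hij'.not_gt
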